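/- arXiv:1611.02993 — 2 statements merged into one kernel-verified Lean document; each statement's English description precedes it below -/
import Mathlib

section
/- Let A₀ : D(A₀) ⊆ H₀ → H₁ and A₁ : D(A₁) ⊆ H₁ → H₂ be densely defined closed linear operators between Hilbert spaces with R(A₀) ⊆ N(A₁), and set K := N(A₁) ∩ N(A₀*). The following are equivalent: (a) the embeddings of D(A₁) ∩ closure(R(A₁*)) (with graph norm of A₁) into H₁, of D(A₀*) ∩ closure(R(A₀)) (with graph norm of A₀*) into H₁, and of K into H₁ are all compact; (b) the embedding of D(A₁) ∩ D(A₀*), equipped with the norm ‖x‖² = ‖x‖²_{H₁} + ‖A₁x‖²_{H₂} + ‖A₀*x‖²_{H₀}, into H₁ is compact. In this case K is finite dimensional. -/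
open Submodule LinearPMap RealInnerProductSpace

noncomputable section

/-- The range of a partially defined linear operator, as a submodule. -/
def pRan {E F : Type*} [AddCommGroup E] [Module ℝ E] [AddCommGroup F] [Module ℝ F]
    (A : E →ₗ.[ℝ] F) : Submodule ℝ F :=
  LinearMap.range A.toFun

/-- The kernel of a partially defined linear operator, as a submodule of the ambient space. -/
def pKer {E F : Type*} [AddCommGroup E] [Module ℝ E] [AddCommGroup F] [Module ℝ F]
    (A : E →ₗ.[ℝ] F) : Submodule ℝ E :=
  (LinearMap.ker A.toFun).map A.domain.subtype

variable {H₀ H₁ H₂ : Type*}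
  [NormedAddCommGroup H₀] [InnerProductSpace ℝ H₀] [CompleteSpace H₀]
  [NormedAddCommGroup H₁] [InnerProductSpace ℝ H₁] [CompleteSpace H₁]
  [NormedAddCommGroup H₂] [InnerProductSpace ℝ H₂] [CompleteSpace H₂]

theorem mem_pKer_iff {E F : Type*} [AddCommGroup E] [Module ℝ E] [AddCommGroup F] [Module ℝ F]
    {A : E →ₗ.[ℝ] F} {x : E} : x ∈ pKer A ↔ ∃ hx : x ∈ A.domain, A ⟨x, hx⟩ = 0 := by
  simp only [pKer, mem_map, LinearMap.mem_ker, Subtype.exists, subtype_apply]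
  constructor
  · rintro ⟨y, hy, h, rfl⟩
    exact ⟨hy, h⟩
  · rintro ⟨hx, h⟩
    exact ⟨x, hx, h, rfl⟩

theorem apply_mem_pRan {E F : Type*} [AddCommGroup E] [Module ℝ E] [AddCommGroup F] [Module ℝ F]
    (A : E →ₗ.[ℝ] F) (x : A.domain) : A x ∈ pRan A :=
  ⟨x, rfl⟩

theorem exists_apply_eq_of_sub_mem_pKer {E F : Type*} [AddCommGroup E] [Module ℝ E]
    [AddCommGroup F] [Module ℝ F] {A : E →ₗ.[ℝ] F} {x y : E} (hx : x ∈ A.domain)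
    (h : x - y ∈ pKer A) : ∃ hy : y ∈ A.domain, A ⟨y, hy⟩ = A ⟨x, hx⟩ := by
  obtain ⟨hd, h0⟩ := mem_pKer_iff.1 h
  have hy : y ∈ A.domain := by simpa using A.domain.sub_mem hx hd
  refine ⟨hy, ?_⟩
  have h1 : A (⟨x, hx⟩ - ⟨y, hy⟩) = 0 := h0
  rw [LinearPMap.map_sub, sub_eq_zero] at h1
  exact h1.symm

section Adjoint

variable {E F : Type*} [NormedAddCommGroup E] [InnerProductSpace ℝ E] [CompleteSpace E]
  [NormedAddCommGroup F] [InnerProductSpace ℝ F]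

/-- The kernel of the adjoint is the orthogonal complement of the range. -/
theorem pKer_adjoint {A : E →ₗ.[ℝ] F} (hA : Dense (A.domain : Set E)) :
    pKer (A†) = (pRan A)ᗮ := by
  ext y
  rw [mem_pKer_iff, mem_orthogonal']
  constructor
  · rintro ⟨hy, h⟩ _ ⟨x, rfl⟩
    have := adjoint_isFormalAdjoint hA ⟨y, hy⟩ x
    rw [h, inner_zero_left] at this
    exact this.symm
  · intro h
    have h0 : ∀ x : A.domain, ⟪(0 : E), x⟫ = ⟪y, A x⟫ := fun x => by
      rw [inner_zero_left, h _ (apply_mem_pRan A x)]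
    exact ⟨mem_adjoint_domain_of_exists y ⟨0, h0⟩, adjoint_apply_eq hA _ h0⟩

/-- Every vector of the domain side splits as `u + A†A u`, for a closed operator `A`. -/
theorem exists_inner_graph_eq [CompleteSpace F] {A : E →ₗ.[ℝ] F} (hc : A.IsClosed) (x : E) :
    ∃ u : A.domain, ∀ v : A.domain, ⟪x - u, (v : E)⟫ = ⟪A u, A v⟫ := by
  let G : Submodule ℝ (WithLp 2 (E × F)) :=
    A.graph.comap (WithLp.linearEquiv 2 ℝ (E × F)).toLinearMap
  have hG : IsClosed (G : Set (WithLp 2 (E × F))) :=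
    IsClosed.preimage (WithLp.prod_continuous_ofLp 2 E F) hc
  have : CompleteSpace G := hG.completeSpace_coe
  let z : WithLp 2 (E × F) := WithLp.toLp 2 (x, 0)
  obtain ⟨u, hu₁, hu₂⟩ := (A.mem_graph_iff).1 (G.starProjection_apply_mem z)
  refine ⟨u, fun v => ?_⟩
  have hv : WithLp.toLp 2 ((v : E), A v) ∈ G := A.mem_graph v
  have h := (mem_orthogonal' _ _).1 (G.sub_starProjection_mem_orthogonal z) _ hv
  have hz : G.starProjection z = WithLp.toLp 2 ((u : E), A u) := by
    apply WithLp.ofLp_injective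
    exact Prod.ext hu₁.symm hu₂.symm
  rw [hz, WithLp.prod_inner_apply] at h
  simpa [z, ← sub_eq_add_neg, sub_eq_zero] using h

/-- The kernel of a closed operator is the orthogonal complement of the range of its adjoint. -/
theorem pKer_eq_orthogonal [CompleteSpace F] {A : E →ₗ.[ℝ] F} (hA : Dense (A.domain : Set E))
    (hc : A.IsClosed) : pKer A = (pRan (A†))ᗮ := by
  ext x
  rw [mem_pKer_iff, mem_orthogonal']
  constructor
  · rintro ⟨hx, h⟩ _ ⟨y, rfl⟩
    have := (adjoint_isFormalAdjoint hA).symm ⟨x, hx⟩ y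
    rw [h, inner_zero_left] at this
    exact this.symm
  · intro h
    obtain ⟨u, hu⟩ := exists_inner_graph_eq hc x
    have hd : A u ∈ (A†).domain := mem_adjoint_domain_of_exists _ ⟨x - u, hu⟩
    have hval : A† ⟨A u, hd⟩ = x - u := adjoint_apply_eq hA _ hu
    have h0 : ⟪x, x - u⟫ = 0 := hval ▸ h _ (apply_mem_pRan _ _)
    have h1 : ⟪x - u, x - (u : E)⟫ = - ⟪A u, A u⟫ := by
      rw [← hu u, inner_sub_left, h0, real_inner_comm, zero_sub]
    have h2 := real_inner_self_nonneg (x := x - (u : E))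
    have h3 := real_inner_self_nonneg (x := A u)
    have hxu : x = u := sub_eq_zero.1 (inner_self_eq_zero (𝕜 := ℝ).1 (by linarith))
    subst hxu
    exact ⟨u.2, inner_self_eq_zero (𝕜 := ℝ).1 (by linarith)⟩

end Adjoint

/-- Orthogonal splitting along two mutually orthogonal closed subspaces. -/
theorem exists_add_add_eq_of_le_orthogonal {E : Type*} [NormedAddCommGroup E]
    [InnerProductSpace ℝ E] (M N : Submodule ℝ E) [M.HasOrthogonalProjection]
    [N.HasOrthogonalProjection] (h : N ≤ Mᗮ) (x : E) :
    ∃ p ∈ M, ∃ q ∈ N, ∃ k ∈ Mᗮ ⊓ Nᗮ, p + q + k = x ∧ x - p ∈ Mᗮ ∧ x - q ∈ Nᗮ ∧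
      ‖p‖ ≤ ‖x‖ ∧ ‖q‖ ≤ ‖x‖ ∧ ‖k‖ ≤ ‖x‖ := by
  have hp := M.starProjection_apply_mem x
  have hq := N.starProjection_apply_mem x
  have hxp := M.sub_starProjection_mem_orthogonal x
  have hxq := N.sub_starProjection_mem_orthogonal x
  have hpn := M.norm_starProjection_apply_le x
  have hqn := N.norm_starProjection_apply_le x
  set p := M.starProjection x
  set q := N.starProjection x
  have hpN : p ∈ Nᗮ := (le_orthogonal_iff_le_orthogonal.1 h) hp
  have hk₁ : x - p - q ∈ Mᗮ := sub_mem hxp (h hq)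
  have hk₂ : x - p - q ∈ Nᗮ := by
    rw [sub_right_comm]
    exact sub_mem hxq hpN
  refine ⟨p, hp, q, hq, x - p - q, ⟨hk₁, hk₂⟩, by abel, hxp, hxq, hpn, hqn, ?_⟩
  have h1 : ‖x - p - q‖ ^ 2 = ⟪x, x - p - q⟫ := by
    rw [← real_inner_self_eq_norm_sq]
    nth_rewrite 1 [inner_sub_left, inner_sub_left]
    rw [inner_right_of_mem_orthogonal hp hk₁, inner_right_of_mem_orthogonal hq hk₂]
    simp
  have h2 := real_inner_le_norm x (x - p - q)
  by_contra! hlt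
  nlinarith [norm_nonneg x, norm_nonneg (x - p - q)]

theorem finiteDimensional_of_isCompact_closure_unitBall {E : Type*} [NormedAddCommGroup E]
    [NormedSpace ℝ E] {K : Submodule ℝ E} (hK : IsClosed (K : Set E))
    (hc : IsCompact (closure {x : E | x ∈ K ∧ ‖x‖ ≤ 1})) : FiniteDimensional ℝ K := by
  have hcl : IsClosed {x : E | x ∈ K ∧ ‖x‖ ≤ 1} :=
    hK.inter (isClosed_le continuous_norm continuous_const)
  rw [hcl.closure_eq] at hc
  refine FiniteDimensional.of_isCompact_closedBall₀ ℝ one_pos ?_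
  rw [Topology.IsInducing.subtypeVal.isCompact_iff]
  convert hc using 1
  ext x
  simp [and_comm]

/-- For densely defined closed operators `A₀, A₁` with `R(A₀) ⊆ N(A₁)` and
`K = N(A₁) ∩ N(A₀†)`: the embeddings of `D(A₁) ∩ closure R(A₁†)` (graph norm of `A₁`), of
`D(A₀†) ∩ closure R(A₀)` (graph norm of `A₀†`) and of `K` into `H₁` are all compact if and only
if the embedding of `D(A₁) ∩ D(A₀†)` with the combined graph norm into `H₁` is compact; in this
case `K` is finite dimensional. Compactness of an embedding is expressed as relative compactness
of the corresponding unit ball. -/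
theorem statement7 (A₀ : H₀ →ₗ.[ℝ] H₁) (A₁ : H₁ →ₗ.[ℝ] H₂)
    (hdense₀ : Dense (A₀.domain : Set H₀)) (hdense₁ : Dense (A₁.domain : Set H₁))
    (hclosed₀ : A₀.IsClosed) (hclosed₁ : A₁.IsClosed)
    (hcomplex : pRan A₀ ≤ pKer A₁) :
    ((IsCompact (closure {x : H₁ | ∃ hx : x ∈ A₁.domain,
          x ∈ (pRan (A₁†)).topologicalClosure ∧ ‖x‖ ^ 2 + ‖A₁ ⟨x, hx⟩‖ ^ 2 ≤ 1})
        ∧ IsCompact (closure {x : H₁ | ∃ hx : x ∈ (A₀†).domain,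
          x ∈ (pRan A₀).topologicalClosure ∧ ‖x‖ ^ 2 + ‖A₀† ⟨x, hx⟩‖ ^ 2 ≤ 1})
        ∧ IsCompact (closure {x : H₁ | x ∈ pKer A₁ ⊓ pKer (A₀†) ∧ ‖x‖ ≤ 1})) ↔
      IsCompact (closure {x : H₁ | ∃ (hx₁ : x ∈ A₁.domain) (hx₀ : x ∈ (A₀†).domain),
        ‖x‖ ^ 2 + ‖A₁ ⟨x, hx₁⟩‖ ^ 2 + ‖A₀† ⟨x, hx₀⟩‖ ^ 2 ≤ 1}))
    ∧ (IsCompact (closure {x : H₁ | ∃ (hx₁ : x ∈ A₁.domain) (hx₀ : x ∈ (A₀†).domain),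
          ‖x‖ ^ 2 + ‖A₁ ⟨x, hx₁⟩‖ ^ 2 + ‖A₀† ⟨x, hx₀⟩‖ ^ 2 ≤ 1}) →
        FiniteDimensional ℝ ↥(pKer A₁ ⊓ pKer (A₀†))) := by
  have hN₁ := pKer_eq_orthogonal hdense₁ hclosed₁
  have hN₀ := pKer_adjoint hdense₀
  set M := (pRan (A₁†)).topologicalClosure with hM
  set N := (pRan A₀).topologicalClosure with hN
  rw [← orthogonal_closure, ← hM] at hN₁
  rw [← orthogonal_closure, ← hN] at hN₀
  have hNM : N ≤ Mᗮ :=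
    topologicalClosure_minimal _ (hN₁ ▸ hcomplex) (isClosed_orthogonal _)
  have hMN : M ≤ Nᗮ := le_orthogonal_iff_le_orthogonal.1 hNM
  have : CompleteSpace M := (isClosed_topologicalClosure _).completeSpace_coe
  have : CompleteSpace N := (isClosed_topologicalClosure _).completeSpace_coe
  have hK : IsCompact (closure {x : H₁ | ∃ (hx₁ : x ∈ A₁.domain) (hx₀ : x ∈ (A₀†).domain),
        ‖x‖ ^ 2 + ‖A₁ ⟨x, hx₁⟩‖ ^ 2 + ‖A₀† ⟨x, hx₀⟩‖ ^ 2 ≤ 1}) →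
      IsCompact (closure {x : H₁ | x ∈ pKer A₁ ⊓ pKer (A₀†) ∧ ‖x‖ ≤ 1}) := by
    refine fun h => h.closure_of_subset (subset_trans ?_ subset_closure)
    rintro x ⟨⟨h₁, h₀⟩, hx⟩
    obtain ⟨hx₁, e₁⟩ := mem_pKer_iff.1 h₁
    obtain ⟨hx₀, e₀⟩ := mem_pKer_iff.1 h₀
    refine ⟨hx₁, hx₀, ?_⟩
    rw [e₁, e₀]
    simpa using hx
  refine ⟨⟨?_, fun h => ⟨?_, ?_, hK h⟩⟩, fun h => ?_⟩
  · rintro ⟨hc₁, hc₂, hc₃⟩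
    refine ((hc₁.add hc₂).add hc₃).closure_of_subset ?_
    rintro x ⟨hx₁, hx₀, hx⟩
    obtain ⟨p, hp, q, hq, k, hk, rfl, hxp, hxq, hpn, hqn, hkn⟩ :=
      exists_add_add_eq_of_le_orthogonal M N hNM x
    obtain ⟨hp₁, ep⟩ := exists_apply_eq_of_sub_mem_pKer hx₁ (hN₁ ▸ hxp)
    obtain ⟨hq₀, eq⟩ := exists_apply_eq_of_sub_mem_pKer hx₀ (hN₀ ▸ hxq)
    have hp2 := pow_le_pow_left₀ (norm_nonneg _) hpn 2
    have hq2 := pow_le_pow_left₀ (norm_nonneg _) hqn 2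
    refine Set.add_mem_add (Set.add_mem_add (subset_closure ⟨hp₁, hp, ?_⟩)
      (subset_closure ⟨hq₀, hq, ?_⟩)) (subset_closure ⟨?_, ?_⟩)
    · rw [ep]
      linarith [sq_nonneg ‖A₀† ⟨_, hx₀⟩‖]
    · rw [eq]
      linarith [sq_nonneg ‖A₁ ⟨_, hx₁⟩‖]
    · rwa [hN₁, hN₀]
    · refine hkn.trans ((sq_le_one_iff₀ (norm_nonneg _)).1 ?_)
      linarith [sq_nonneg ‖A₀† ⟨_, hx₀⟩‖, sq_nonneg ‖A₁ ⟨_, hx₁⟩‖]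
  · refine h.closure_of_subset (subset_trans ?_ subset_closure)
    rintro x ⟨hx₁, hxM, hx⟩
    obtain ⟨hx₀, e₀⟩ := mem_pKer_iff.1 (hN₀ ▸ hMN hxM)
    refine ⟨hx₁, hx₀, ?_⟩
    rw [e₀]
    simpa using hx
  · refine h.closure_of_subset (subset_trans ?_ subset_closure)
    rintro x ⟨hx₀, hxN, hx⟩
    obtain ⟨hx₁, e₁⟩ := mem_pKer_iff.1 (hN₁ ▸ hNM hxN)
    refine ⟨hx₁, hx₀, ?_⟩
    rw [e₁]
    simpa using hx
  · refine finiteDimensional_of_isCompact_closure_unitBall ?_ (hK h)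
    rw [hN₁, hN₀]
    exact (isClosed_orthogonal _).inter (isClosed_orthogonal _)
end
end

section
/- In the first order setting, let x ∈ D₂ be the exact solution of A₂x = f, A₁*x = g, πx = k, let x̃ ∈ H₂ be arbitrary, and set e := x − x̃ and e_K := πe = k − πx̃. Then ‖e_K‖_{H₂} = min over φ ∈ D(A₁) and ψ ∈ D(A₂*) of ‖k − x̃ + A₁φ + A₂*ψ‖_{H₂}, and the minimum is attained at the (unique) φ̂ ∈ D(A₁) ∩ N(A₁)^⊥ and ψ̂ ∈ D(A₂*) ∩ N(A₂*)^⊥ with A₁φ̂ + A₂*ψ̂ = (π_{R(A₁)} + π_{R(A₂*)})x̃ = (1 − π)x̃. -/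
open Submodule LinearPMap RealInnerProductSpace

noncomputable section

variable {H₁ H₂ H₃ : Type*}
  [NormedAddCommGroup H₁] [InnerProductSpace ℝ H₁] [CompleteSpace H₁]
  [NormedAddCommGroup H₂] [InnerProductSpace ℝ H₂] [CompleteSpace H₂]
  [NormedAddCommGroup H₃] [InnerProductSpace ℝ H₃] [CompleteSpace H₃]

theorem mem_pRan {E F : Type*} [AddCommGroup E] [Module ℝ E] [AddCommGroup F] [Module ℝ F]
    {A : E →ₗ.[ℝ] F} {y : F} : y ∈ pRan A ↔ ∃ x : A.domain, A x = y :=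
  Iff.rfl

theorem mem_pKer {E F : Type*} [AddCommGroup E] [Module ℝ E] [AddCommGroup F] [Module ℝ F]
    {A : E →ₗ.[ℝ] F} {x : E} : x ∈ pKer A ↔ ∃ h : x ∈ A.domain, A ⟨x, h⟩ = 0 := by
  constructor
  · rintro ⟨y, hy, rfl⟩
    exact ⟨y.2, hy⟩
  · rintro ⟨h, hx⟩
    exact ⟨⟨x, h⟩, hx, rfl⟩

section AdjointRange

variable {E F : Type*} [NormedAddCommGroup E] [InnerProductSpace ℝ E]
  [NormedAddCommGroup F] [InnerProductSpace ℝ F] {A : E →ₗ.[ℝ] F}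

theorem isClosed_pKer (hA : A.IsClosed) : IsClosed (pKer A : Set E) := by
  have h : (pKer A : Set E) = (fun x : E => (x, (0 : F))) ⁻¹' (A.graph : Set (E × F)) := by
    ext x
    simp [mem_pKer, LinearPMap.mem_graph_iff]
  rw [h]
  exact IsClosed.preimage (by fun_prop) hA

theorem eq_of_apply_eq_of_mem_pKer_orthogonal {x y : A.domain} (hx : (x : E) ∈ (pKer A)ᗮ)
    (hy : (y : E) ∈ (pKer A)ᗮ) (h : A x = A y) : x = y := by
  have hker : (x : E) - y ∈ pKer A :=
    mem_pKer.2 ⟨(x - y).2, (A.map_sub x y).trans (sub_eq_zero.2 h)⟩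
  exact Subtype.ext (sub_eq_zero.1 (inner_self_eq_zero.1
    ((pKer A)ᗮ.sub_mem hx hy _ hker)))

variable [CompleteSpace E]

theorem exists_mem_pKer_orthogonal_apply_eq (hA : A.IsClosed) {y : F} (hy : y ∈ pRan A) :
    ∃ x : A.domain, (x : E) ∈ (pKer A)ᗮ ∧ A x = y := by
  obtain ⟨x, rfl⟩ := mem_pRan.1 hy
  have : CompleteSpace (pKer A) := (isClosed_pKer hA).completeSpace_coe
  obtain ⟨n, hn, p, hp, hx⟩ := (pKer A).exists_add_mem_mem_orthogonal (x : E)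
  obtain ⟨hnD, hn0⟩ := mem_pKer.1 hn
  refine ⟨x - ⟨n, hnD⟩, ?_, by rw [A.map_sub, hn0, sub_zero]⟩
  simpa [hx] using hp

theorem pKer_adjoint_eq (hA : Dense (A.domain : Set E)) : pKer (A†) = (pRan A)ᗮ := by
  ext y
  rw [mem_pKer, Submodule.mem_orthogonal']
  constructor
  · rintro ⟨hy, hy0⟩ _ ⟨x, rfl⟩
    have h := adjoint_isFormalAdjoint hA ⟨y, hy⟩ x
    rw [hy0, inner_zero_left] at h
    exact h.symm
  · intro h
    have h0 (x : A.domain) : inner ℝ (0 : E) x = inner ℝ y (A x) := by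
      rw [inner_zero_left, h (A x) ⟨x, rfl⟩]
    have hy := mem_adjoint_domain_of_exists y ⟨0, h0⟩
    exact ⟨hy, adjoint_apply_eq hA ⟨y, hy⟩ h0⟩

theorem adjoint_apply_mem_pKer_orthogonal (hA : Dense (A.domain : Set E)) (y : (A†).domain) :
    A† y ∈ (pKer A)ᗮ := by
  rw [Submodule.mem_orthogonal']
  intro x hx
  obtain ⟨hxD, hx0⟩ := mem_pKer.1 hx
  have h := adjoint_isFormalAdjoint hA y ⟨x, hxD⟩
  rwa [hx0, inner_zero_right] at h

/-- Closed range theorem: if a densely defined closed operator has closed range, then the adjoint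
maps onto the orthogonal complement of the kernel; the preimage can be chosen in the range. -/
theorem exists_mem_pRan_adjoint_apply_eq [CompleteSpace F] (hA : Dense (A.domain : Set E))
    (hclosed : A.IsClosed) (hrange : IsClosed (pRan A : Set F)) {v : E} (hv : v ∈ (pKer A)ᗮ) :
    ∃ y : (A†).domain, (y : F) ∈ pRan A ∧ A† y = v := by
  have hgraph : _root_.IsClosed (A.graph : Set (E × F)) := hclosed
  have : CompleteSpace A.graph := hgraph.completeSpace_coe
  have : CompleteSpace (pRan A) := hrange.completeSpace_coe
  let T : A.graph →L[ℝ] pRan A :=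
    ((ContinuousLinearMap.snd ℝ E F).comp A.graph.subtypeL).codRestrict (pRan A) fun z => by
      obtain ⟨x, -, hx⟩ := (A.mem_graph_iff).1 z.2
      exact mem_pRan.2 ⟨x, hx⟩
  have hT : T.range = ⊤ := by
    rw [LinearMap.range_eq_top]
    rintro ⟨_, x, rfl⟩
    exact ⟨⟨_, A.mem_graph x⟩, rfl⟩
  let S := T.nonlinearRightInverseOfSurjective hT
  have hS (y : pRan A) : ((S y : E × F).1, (y : F)) ∈ A.graph := by
    have h : T (S y) = y := S.right_inv y
    have h2 : (S y : E × F).2 = y := congrArg Subtype.val h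
    rw [← h2]
    exact (S y).2
  have key {a b : E} {c : F} (ha : (a, c) ∈ A.graph) (hb : (b, c) ∈ A.graph) :
      inner ℝ v a = inner ℝ v b := by
    have hab : a - b ∈ pKer A := by
      have h := A.graph.sub_mem ha hb
      rw [Prod.mk_sub_mk, sub_self, A.mem_graph_iff] at h
      obtain ⟨x, hx, hx0⟩ := h
      have hx : (x : E) = a - b := hx
      exact mem_pKer.2 ⟨hx ▸ x.2, by simpa [← hx] using hx0⟩
    rw [← sub_eq_zero, ← inner_sub_right]
    exact (Submodule.mem_orthogonal' _ _).1 hv _ hab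
  let l : pRan A →ₗ[ℝ] ℝ :=
    { toFun := fun y => inner ℝ v (S y : E × F).1
      map_add' := fun y z => by
        rw [← inner_add_right]
        exact key (hS (y + z)) (A.graph.add_mem (hS y) (hS z))
      map_smul' := fun c y => by
        rw [RingHom.id_apply, smul_eq_mul, ← real_inner_smul_right]
        exact key (hS (c • y)) (A.graph.smul_mem c (hS y)) }
  let L : StrongDual ℝ (pRan A) := l.mkContinuous (‖v‖ * S.nnnorm) fun y =>
    calc ‖l y‖ ≤ ‖v‖ * ‖(S y : E × F).1‖ := norm_inner_le_norm _ _
      _ ≤ ‖v‖ * ‖S y‖ := by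
        gcongr
        exact norm_fst_le _
      _ ≤ ‖v‖ * (S.nnnorm * ‖y‖) := by
        gcongr
        exact S.bound y
      _ = ‖v‖ * S.nnnorm * ‖y‖ := by ring
  let w : pRan A := (InnerProductSpace.toDual ℝ (pRan A)).symm L
  have hw (x : A.domain) : inner ℝ v (x : E) = inner ℝ (w : F) (A x) := by
    have h : inner ℝ w (⟨A x, x, rfl⟩ : pRan A) = L ⟨A x, x, rfl⟩ :=
      InnerProductSpace.toDual_symm_apply
    exact (key (A.mem_graph x) (hS ⟨A x, x, rfl⟩)).trans h.symm
  have hwD := mem_adjoint_domain_of_exists (w : F) ⟨v, hw⟩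
  exact ⟨⟨w, hwD⟩, w.2, adjoint_apply_eq hA ⟨w, hwD⟩ hw⟩

end AdjointRange

/-- If `U` is a complete subspace of `N`, then a vector orthogonal to both `U` and `N ⊓ Uᗮ` is
orthogonal to `N`. -/
theorem mem_orthogonal_of_le_of_mem_inf_orthogonal {E : Type*} [NormedAddCommGroup E]
    [InnerProductSpace ℝ E] {U N : Submodule ℝ E} [CompleteSpace U] (hUN : U ≤ N) {b : E}
    (hU : b ∈ Uᗮ) (hN : b ∈ (N ⊓ Uᗮ)ᗮ) : b ∈ Nᗮ := by
  intro n hn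
  obtain ⟨p, hp, q, hq, rfl⟩ := U.exists_add_mem_mem_orthogonal n
  have hqN : q ∈ N := by simpa using N.sub_mem hn (hUN hp)
  rw [inner_add_left, hU p hp, hN q ⟨hqN, hq⟩, add_zero]

theorem norm_le_norm_add_of_mem_orthogonal {E : Type*} [NormedAddCommGroup E]
    [InnerProductSpace ℝ E] {K : Submodule ℝ E} {m r : E} (hm : m ∈ K) (hr : r ∈ Kᗮ) :
    ‖m‖ ≤ ‖m + r‖ := by
  have h := norm_add_sq_eq_norm_sq_add_norm_sq_of_inner_eq_zero m r (hr m hm)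
  nlinarith [norm_nonneg (m + r), mul_self_nonneg ‖r‖, norm_nonneg m]

/-- Functional a posteriori error estimate, upper bound for the cohomology
part of the error: with `e = x - xt` and `e_K = π e = k - π xt` (here `kt = π xt`),
`‖e_K‖ = min_{φ ∈ D(A₁), ψ ∈ D(A₂†)} ‖k - xt + A₁φ + A₂†ψ‖`, the minimum being attained at the
unique `φ̂ ∈ D(A₁) ∩ N(A₁)^⊥`, `ψ̂ ∈ D(A₂†) ∩ N(A₂†)^⊥` with
`A₁φ̂ + A₂†ψ̂ = (π_{R(A₁)} + π_{R(A₂†)}) xt = (1 - π) xt`. -/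
theorem statement13 (A₁ : H₁ →ₗ.[ℝ] H₂) (A₂ : H₂ →ₗ.[ℝ] H₃)
    (hdense₁ : Dense (A₁.domain : Set H₁)) (hdense₂ : Dense (A₂.domain : Set H₂))
    (hclosed₁ : A₁.IsClosed) (hclosed₂ : A₂.IsClosed)
    (hcomplex : pRan A₁ ≤ pKer A₂)
    (hrange₁ : IsClosed (pRan A₁ : Set H₂)) (hrange₂ : IsClosed (pRan A₂ : Set H₃))
    (f : H₃) (g : H₁) (k : H₂)
    (hf : f ∈ pRan A₂) (hg : g ∈ pRan (A₁†)) (hk : k ∈ pKer A₂ ⊓ pKer (A₁†))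
    -- `x ∈ D₂` is the exact solution: `A₂ x = f`, `A₁† x = g`, `π x = k`
    (x : H₂) (hx₂ : x ∈ A₂.domain) (hx₁ : x ∈ (A₁†).domain)
    (hxf : A₂ ⟨x, hx₂⟩ = f) (hxg : A₁† ⟨x, hx₁⟩ = g)
    (hxk : x - k ∈ (pKer A₂ ⊓ pKer (A₁†))ᗮ)
    -- `xt` is an arbitrary (possibly nonconforming) approximation
    (xt : H₂)
    -- `kt = π xt`
    (kt : H₂) (hkt : kt ∈ pKer A₂ ⊓ pKer (A₁†))
    (hktperp : xt - kt ∈ (pKer A₂ ⊓ pKer (A₁†))ᗮ) :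
    IsLeast {r : ℝ | ∃ (φ : A₁.domain) (ψ : (A₂†).domain),
      r = ‖k - xt + A₁ φ + A₂† ψ‖} ‖k - kt‖
    -- the minimum is attained at `φ̂, ψ̂` with `A₁φ̂ + A₂†ψ̂ = xt - π xt`
    ∧ (∃ (φ : A₁.domain) (ψ : (A₂†).domain),
        (φ : H₁) ∈ (pKer A₁)ᗮ ∧ (ψ : H₃) ∈ (pKer (A₂†))ᗮ
        ∧ A₁ φ + A₂† ψ = xt - kt
        ∧ ‖k - xt + A₁ φ + A₂† ψ‖ = ‖k - kt‖)
    -- uniqueness of such `φ̂, ψ̂`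
    ∧ (∀ (φ φ' : A₁.domain) (ψ ψ' : (A₂†).domain),
        (φ : H₁) ∈ (pKer A₁)ᗮ → (ψ : H₃) ∈ (pKer (A₂†))ᗮ →
        (φ' : H₁) ∈ (pKer A₁)ᗮ → (ψ' : H₃) ∈ (pKer (A₂†))ᗮ →
        A₁ φ + A₂† ψ = xt - kt → A₁ φ' + A₂† ψ' = xt - kt → φ = φ' ∧ ψ = ψ') := by
  have hK₁ : pKer (A₁†) = (pRan A₁)ᗮ := pKer_adjoint_eq hdense₁
  have : CompleteSpace (pRan A₁) := hrange₁.completeSpace_coe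
  have hex : ∃ (φ : A₁.domain) (ψ : (A₂†).domain),
      (φ : H₁) ∈ (pKer A₁)ᗮ ∧ (ψ : H₃) ∈ (pKer (A₂†))ᗮ ∧ A₁ φ + A₂† ψ = xt - kt := by
    obtain ⟨a, ha, b, hb, hab⟩ := (pRan A₁).exists_add_mem_mem_orthogonal (xt - kt)
    have haK : a ∈ (pKer A₂ ⊓ (pRan A₁)ᗮ)ᗮ :=
      Submodule.orthogonal_le inf_le_right (Submodule.le_orthogonal_orthogonal _ ha)
    have hbK : b ∈ (pKer A₂ ⊓ (pRan A₁)ᗮ)ᗮ := by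
      rw [hK₁, hab] at hktperp
      simpa using Submodule.sub_mem _ hktperp haK
    obtain ⟨φ, hφ, hφa⟩ := exists_mem_pKer_orthogonal_apply_eq hclosed₁ ha
    obtain ⟨ψ, hψ, hψb⟩ := exists_mem_pRan_adjoint_apply_eq hdense₂ hclosed₂ hrange₂
      (mem_orthogonal_of_le_of_mem_inf_orthogonal hcomplex hb hbK)
    refine ⟨φ, ψ, hφ, ?_, by rw [hφa, hψb, hab]⟩
    rw [pKer_adjoint_eq hdense₂]
    exact Submodule.le_orthogonal_orthogonal _ hψ
  have hnorm (φ : A₁.domain) (ψ : (A₂†).domain) (h : A₁ φ + A₂† ψ = xt - kt) :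
      ‖k - xt + A₁ φ + A₂† ψ‖ = ‖k - kt‖ := by
    rw [add_assoc, h, sub_add_sub_cancel]
  obtain ⟨φ, ψ, hφ, hψ, h⟩ := hex
  refine ⟨⟨⟨φ, ψ, (hnorm φ ψ h).symm⟩, ?_⟩, ⟨φ, ψ, hφ, hψ, h, hnorm φ ψ h⟩, ?_⟩
  · rintro _ ⟨φ', ψ', rfl⟩
    have h₁ : A₁ φ' ∈ (pKer A₂ ⊓ pKer (A₁†))ᗮ := by
      rw [hK₁]
      exact Submodule.orthogonal_le inf_le_right
        (Submodule.le_orthogonal_orthogonal _ (mem_pRan.2 ⟨φ', rfl⟩))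
    have h₂ : A₂† ψ' ∈ (pKer A₂ ⊓ pKer (A₁†))ᗮ :=
      Submodule.orthogonal_le inf_le_left (adjoint_apply_mem_pKer_orthogonal hdense₂ ψ')
    convert norm_le_norm_add_of_mem_orthogonal (Submodule.sub_mem _ hk hkt)
      (Submodule.sub_mem _ (Submodule.add_mem _ h₁ h₂) hktperp) using 2
    abel
  · intro φ φ' ψ ψ' hφ hψ hφ' hψ' h h'
    have hsub : A₁ φ - A₁ φ' = A₂† ψ' - A₂† ψ := by
      rw [sub_eq_sub_iff_add_eq_add, h, add_comm, h']
    have hker : A₁ φ - A₁ φ' ∈ pKer A₂ :=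
      hcomplex (Submodule.sub_mem _ (mem_pRan.2 ⟨φ, rfl⟩) (mem_pRan.2 ⟨φ', rfl⟩))
    have hperp : A₁ φ - A₁ φ' ∈ (pKer A₂)ᗮ := by
      rw [hsub]
      exact Submodule.sub_mem _ (adjoint_apply_mem_pKer_orthogonal hdense₂ ψ')
        (adjoint_apply_mem_pKer_orthogonal hdense₂ ψ)
    have h0 : A₁ φ - A₁ φ' = 0 := inner_self_eq_zero.1 (hperp _ hker)
    exact ⟨eq_of_apply_eq_of_mem_pKer_orthogonal hφ hφ' (sub_eq_zero.1 h0),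
      eq_of_apply_eq_of_mem_pKer_orthogonal hψ hψ' (sub_eq_zero.1 (hsub.symm.trans h0)).symm⟩
end
end
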